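/- Let R be a commutative ring, B a formally smooth R-algebra, and C an R-algebra such that Ω¹_{C/R} is generated by a single element as a C-module. Set S = B ⊗_R C. Then there is a canonical isomorphism of S-modules Ω²_{S/R} ≅ (Ω¹_{B/R} ⊗_R Ω¹_{C/R}) ⊕ (Ω²_{B/R} ⊗_R C), where Ω²_{T/R} denotes the second exterior power over T of Ω¹_{T/R}. -/

import Mathlib

open TensorProduct

attribute [local instance] Algebra.TensorProduct.rightAlgebra

namespace LinearMap

/-- An alternating bilinear map, as an alternating map on `Fin 2`. -/
def IsAlt.toAlternatingMap {R M N : Type*} [CommRing R] [AddCommGroup M] [AddCommGroup N]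
    [Module R M] [Module R N] {f : M →ₗ[R] M →ₗ[R] N} (hf : f.IsAlt) : M [⋀^Fin 2]→ₗ[R] N where
  toFun v := f (v 0) (v 1)
  map_update_add' v i x y := by fin_cases i <;> simp
  map_update_smul' v i c x := by fin_cases i <;> simp
  map_eq_zero_of_eq' v i j h hij := by
    fin_cases i <;> fin_cases j <;> simp_all [hf.self_eq_zero]

@[simp]
theorem IsAlt.toAlternatingMap_apply {R M N : Type*} [CommRing R] [AddCommGroup M]
    [AddCommGroup N] [Module R M] [Module R N] {f : M →ₗ[R] M →ₗ[R] N} (hf : f.IsAlt)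
    (v : Fin 2 → M) : hf.toAlternatingMap v = f (v 0) (v 1) :=
  rfl

end LinearMap

namespace exteriorPower

section

variable (R M : Type*) [CommRing R] [AddCommGroup M] [Module R M]

/-- The wedge product `x ∧ y` of two vectors as a bilinear map to `⋀[R]^2 M`. -/
noncomputable def wedge : M →ₗ[R] M →ₗ[R] ⋀[R]^2 M :=
  LinearMap.mk₂ R (fun x y ↦ ιMulti R 2 ![x, y])
    (fun x y z ↦ (ιMulti R 2).map_vecCons_add ![z] x y)
    (fun c x y ↦ (ιMulti R 2).map_vecCons_smul ![y] c x)
    (fun x y z ↦ by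
      have h (w : M) : Function.update ![x, 0] 1 w = ![x, w] := by ext i; fin_cases i <;> rfl
      simpa only [h] using (ιMulti R 2).map_update_add ![x, 0] 1 y z)
    (fun c x y ↦ by
      have h (w : M) : Function.update ![x, 0] 1 w = ![x, w] := by ext i; fin_cases i <;> rfl
      simpa only [h] using (ιMulti R 2).map_update_smul ![x, 0] 1 c y)

end

variable {R M N : Type*} [CommRing R] [AddCommGroup M] [Module R M] [AddCommGroup N] [Module R N]

theorem isAlt_wedge : (wedge R M).IsAlt := fun x ↦
  (ιMulti R 2).map_eq_zero_of_eq ![x, x] (i := 0) (j := 1) rfl (by simp)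

theorem ιMulti_two (v : Fin 2 → M) : ιMulti R 2 v = wedge R M (v 0) (v 1) := by
  simp only [wedge, LinearMap.mk₂_apply]
  congr 1
  ext i
  fin_cases i <;> rfl

/-- Linear maps out of `⋀[R]^2 M` are determined by their values on the wedges `x ∧ y`. -/
theorem linearMap_ext_wedge {f g : ⋀[R]^2 M →ₗ[R] N}
    (h : ∀ x y, f (wedge R M x y) = g (wedge R M x y)) : f = g := by
  ext v
  simpa [ιMulti_two] using h (v 0) (v 1)

/-- The linear map on `⋀[R]^2 M` induced by an alternating bilinear map. -/
noncomputable def liftTwo {f : M →ₗ[R] M →ₗ[R] N} (hf : f.IsAlt) : ⋀[R]^2 M →ₗ[R] N :=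
  alternatingMapLinearEquiv hf.toAlternatingMap

@[simp]
theorem liftTwo_wedge {f : M →ₗ[R] M →ₗ[R] N} (hf : f.IsAlt) (x y : M) :
    liftTwo hf (wedge R M x y) = f x y := by
  simp [liftTwo, wedge]

theorem wedge_eq_zero_of_span_singleton {ω : M} (hω : Submodule.span R {ω} = ⊤) (x y : M) :
    wedge R M x y = 0 := by
  obtain ⟨a, rfl⟩ := Submodule.mem_span_singleton.1 (hω ▸ Submodule.mem_top : x ∈ R ∙ ω)
  obtain ⟨b, rfl⟩ := Submodule.mem_span_singleton.1 (hω ▸ Submodule.mem_top : y ∈ R ∙ ω)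
  simp [isAlt_wedge.self_eq_zero]

@[simp]
theorem map_wedge (f : M →ₗ[R] N) (x y : M) :
    map 2 f (wedge R M x y) = wedge R N (f x) (f y) := by
  refine (map_apply_ιMulti f ![x, y]).trans ?_
  simp [ιMulti_two]

/-- If `N` is cyclic, then `⋀²(M × N)` decomposes as `(M ⊗ N) × ⋀² M`. -/
noncomputable def prodEquivOfSpanSingleton {ω : N} (hω : Submodule.span R {ω} = ⊤) :
    ⋀[R]^2 (M × N) ≃ₗ[R] (M ⊗[R] N) × ⋀[R]^2 M := by
  let b : M × N →ₗ[R] M × N →ₗ[R] M ⊗[R] N :=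
    (TensorProduct.mk R M N).compl₁₂ (.fst R M N) (.snd R M N)
  have hb : (b - b.flip).IsAlt := fun x ↦ by simp [b]
  refine LinearEquiv.ofLinearMap ((liftTwo hb).prod (map 2 (.fst R M N)))
    ((TensorProduct.lift ((wedge R (M × N)).compl₁₂ (.inl R M N) (.inr R M N))).coprod
      (map 2 (.inl R M N))) ?_ ?_
  · refine LinearMap.prod_ext (TensorProduct.ext' fun m n ↦ ?_) (linearMap_ext_wedge fun x y ↦ ?_)
    · simp [b]
    · simp [b]
  · refine linearMap_ext_wedge fun x y ↦ ?_
    have hN : wedge R (M × N) (0, x.2) (0, y.2) = 0 := by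
      simpa [wedge_eq_zero_of_span_singleton hω] using
        (map_wedge (LinearMap.inr R M N) x.2 y.2).symm
    have hx : x = (x.1, 0) + (0, x.2) := by simp
    have hy : y = (y.1, 0) + (0, y.2) := by simp
    conv_rhs => rw [hx, hy]
    simp only [map_add, LinearMap.add_apply, hN, LinearMap.id_apply]
    rw [← isAlt_wedge.neg (y.1, 0) (0, x.2)]
    simp [b]
    abel

/-- The second exterior power commutes with base change. -/
noncomputable def baseChangeTwoEquiv (R S M : Type*) [CommRing R] [CommRing S] [Algebra R S]
    [AddCommGroup M] [Module R M] :
    ⋀[S]^2 (S ⊗[R] M) ≃ₗ[S] S ⊗[R] ⋀[R]^2 M := by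
  let b : S ⊗[R] M →ₗ[S] S ⊗[R] M →ₗ[S] S ⊗[R] ⋀[R]^2 M :=
    LinearMap.BilinMap.baseChange S (wedge R M)
  have hb' (x y) : b x y + b y x = 0 := by
    induction x with
    | zero => simp
    | add x x' h h' =>
      simp only [map_add, LinearMap.add_apply]
      rw [add_add_add_comm, h, h', add_zero]
    | tmul s m =>
      induction y with
      | zero => simp
      | add y y' h h' =>
        simp only [map_add, LinearMap.add_apply]
        rw [add_add_add_comm, h, h', add_zero]
      | tmul t n =>
        simp only [b, LinearMap.BilinMap.baseChange_tmul]
        rw [mul_comm t s, ← TensorProduct.tmul_add, ← isAlt_wedge.neg m n, add_neg_cancel,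
          TensorProduct.tmul_zero]
  have hb : b.IsAlt := fun x ↦ by
    induction x with
    | zero => simp
    | add x y hx hy => simp [hx, hy, hb']
    | tmul s m => simp [b, isAlt_wedge.self_eq_zero]
  let c : M →ₗ[R] M →ₗ[R] ⋀[S]^2 (S ⊗[R] M) :=
    ((wedge S (S ⊗[R] M)).restrictScalars₁₂ R R).compl₁₂ (TensorProduct.mk R S M 1)
      (TensorProduct.mk R S M 1)
  have hc : c.IsAlt := fun x ↦ isAlt_wedge.self_eq_zero _
  refine LinearEquiv.ofLinearMap (liftTwo hb) ((liftTwo hc).liftBaseChange S) ?_ ?_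
  · apply TensorProduct.AlgebraTensorModule.curry_injective
    refine LinearMap.ext_ring (linearMap_ext_wedge fun x y ↦ ?_)
    simp [c, b]
  · refine linearMap_ext_wedge fun x y ↦ ?_
    simp only [LinearMap.comp_apply, liftTwo_wedge, LinearMap.id_apply]
    induction x with
    | zero => simp
    | add x x' h h' => simp only [map_add, LinearMap.add_apply, h, h']
    | tmul s m =>
      induction y with
      | zero => simp
      | add y y' h h' => simp only [map_add, h, h']
      | tmul t n =>
        have hs (u : S) (p : M) : u ⊗ₜ[R] p = u • 1 ⊗ₜ[R] p := by simp [TensorProduct.smul_tmul']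
        rw [hs s, hs t]
        simp [b, c]

/-- The equivalence of exterior powers induced by a linear equivalence. -/
noncomputable def mapEquiv (n : ℕ) (e : M ≃ₗ[R] N) : ⋀[R]^n M ≃ₗ[R] ⋀[R]^n N :=
  LinearEquiv.ofLinearMap (map n e.toLinearMap) (map n e.symm.toLinearMap)
    (by rw [← map_comp]; simp) (by rw [← map_comp]; simp)

end exteriorPower

open KaehlerDifferential in
/-- `Ω_{(B ⊗ C)/R}` decomposes as the product of the base changes of `Ω_{B/R}` and `Ω_{C/R}`. -/
noncomputable def KaehlerDifferential.tensorProductEquivProd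
    (R B C : Type*) [CommRing R] [CommRing B] [CommRing C] [Algebra R B] [Algebra R C] :
    Ω[(B ⊗[R] C)⁄R] ≃ₗ[B ⊗[R] C]
      ((B ⊗[R] C) ⊗[B] Ω[B⁄R]) × ((B ⊗[R] C) ⊗[C] Ω[C⁄R]) := by
  refine LinearEquiv.ofLinearMap
    (((tensorKaehlerEquiv R C B (B ⊗[R] C)).symm.toLinearMap ∘ₗ map R C _ _).prod
      ((tensorKaehlerEquiv R B C (B ⊗[R] C)).symm.toLinearMap ∘ₗ map R B _ _))
    ((mapBaseChange R B _).coprod (mapBaseChange R C _)) ?_ ?_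
  · ext
    all_goals simp
    rw [LinearEquiv.symm_apply_eq, tensorKaehlerEquiv_tmul_D, one_smul]
  · apply Derivation.liftKaehlerDifferential_unique
    ext x
    induction x with
    | zero => simp
    | add x y hx hy => simp only [map_add, hx, hy]
    | tmul b c =>
      have hbc : b ⊗ₜ[R] c = (b ⊗ₜ[R] 1) * algebraMap C (B ⊗[R] C) c := by
        simp [Algebra.TensorProduct.right_algebraMap_apply]
      have h := (D R (B ⊗[R] C)).leibniz (b ⊗ₜ[R] 1) (algebraMap C (B ⊗[R] C) c)
      rw [← hbc, algebraMap_smul] at h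
      rw [add_comm] at h
      simpa using h.symm

theorem Submodule.span_singleton_one_tmul_eq_top {R M : Type*} (S : Type*) [CommRing R]
    [CommRing S] [Algebra R S] [AddCommGroup M] [Module R M] {ω : M}
    (hω : Submodule.span R {ω} = ⊤) :
    Submodule.span S {(1 : S) ⊗ₜ[R] ω} = ⊤ := by
  have h := Submodule.baseChange_span (R := R) S {ω}
  rw [hω, Submodule.baseChange_top] at h
  simpa using h.symm

/-- Let `R` be a commutative ring, `B` a formally smooth `R`-algebra, and `C` an
`R`-algebra such that `Ω¹_{C/R}` is generated by a single element as a `C`-module.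
Set `S = B ⊗_R C`.  Then there is a canonical isomorphism of `S`-modules
`Ω²_{S/R} ≅ (Ω¹_{B/R} ⊗_R Ω¹_{C/R}) ⊕ (Ω²_{B/R} ⊗_R C)`, where `Ω²_{T/R}` is the
second exterior power of `Ω¹_{T/R}` over `T` (the summands being realized as the
`S`-modules `(S ⊗_B Ω¹_{B/R}) ⊗_S (S ⊗_C Ω¹_{C/R})` and `S ⊗_B Ω²_{B/R}`). -/
theorem stmt10.{u} (R B C : Type u) [CommRing R] [CommRing B] [CommRing C]
    [Algebra R B] [Algebra R C] [Algebra.FormallySmooth R B]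
    (hC : ∃ ω : Ω[C⁄R], Submodule.span C {ω} = ⊤) :
    Nonempty
      ((⋀[B ⊗[R] C]^2 (Ω[(B ⊗[R] C)⁄R])) ≃ₗ[B ⊗[R] C]
        (((B ⊗[R] C) ⊗[B] Ω[B⁄R]) ⊗[B ⊗[R] C] ((B ⊗[R] C) ⊗[C] Ω[C⁄R])) ×
          ((B ⊗[R] C) ⊗[B] (⋀[B]^2 (Ω[B⁄R])))) := by
  obtain ⟨ω, hω⟩ := hC
  let e₁ := KaehlerDifferential.tensorProductEquivProd R B C
  let e₂ := exteriorPower.prodEquivOfSpanSingleton (M := (B ⊗[R] C) ⊗[B] Ω[B⁄R])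
    (Submodule.span_singleton_one_tmul_eq_top (B ⊗[R] C) hω)
  exact ⟨exteriorPower.mapEquiv 2 e₁ ≪≫ₗ e₂ ≪≫ₗ
    (LinearEquiv.refl _ _).prodCongr (exteriorPower.baseChangeTwoEquiv B (B ⊗[R] C) Ω[B⁄R])⟩
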